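/- arXiv:2504.16410 — 2 statements merged into one kernel-verified Lean document; each statement's English description precedes it below -/
import Mathlib

section
/- Let A be a commutative ring and I ⊆ A an ideal. The formal spectrum Spf_I(A), viewed as a functor from commutative rings to sets, satisfies descent along faithfully flat ring homomorphisms: for every faithfully flat ring homomorphism R → S, the diagram Spf_I(A)(R) → Spf_I(A)(S) ⇉ Spf_I(A)(S ⊗_R S) is an equalizer of sets, where the map Spf_I(A)(R) → Spf_I(A)(S) is postcomposition with R → S and the two parallel maps are postcomposition with s ↦ s ⊗ 1 and s ↦ 1 ⊗ s respectively. -/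
/-!
Faithfully flat descent for the formal spectrum, as a functor to sets.
-/

open scoped TensorProduct

universe u

/-- The set of `R`-points of the formal spectrum `Spf_I(A)`: ring homomorphisms
`A →+* R` killing some power `I ^ n` (`n ≥ 1`) of `I`. -/
def SpfSet {A : Type u} [CommRing A] (I : Ideal A) (R : Type u) [CommRing R] : Type u :=
  {f : A →+* R // ∃ n : ℕ, 1 ≤ n ∧ ∀ a ∈ I ^ n, f a = 0}

/-- Functoriality of `SpfSet` in `R`: postcomposition with a ring homomorphism. -/
def SpfSet.map {A : Type u} [CommRing A] (I : Ideal A) {R S : Type u} [CommRing R] [CommRing S]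
    (g : R →+* S) (f : SpfSet I R) : SpfSet I S :=
  ⟨g.comp f.1, by
    obtain ⟨n, hn1, hn⟩ := f.2
    exact ⟨n, hn1, fun a ha => by simp only [RingHom.comp_apply, hn a ha, map_zero]⟩⟩

/-- **fpqc descent for the formal spectrum.**  For a faithfully flat ring homomorphism
`R → S`, the diagram `Spf_I(A)(R) → Spf_I(A)(S) ⇉ Spf_I(A)(S ⊗_R S)` is an equalizer of
sets: the canonical comparison map from `Spf_I(A)(R)` to the equalizer of the two maps
given by postcomposition with `s ↦ s ⊗ 1` and `s ↦ 1 ⊗ s` is a bijection. -/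
theorem spfSet_descent {A : Type u} [CommRing A] (I : Ideal A)
    {R S : Type u} [CommRing R] [CommRing S] [Algebra R S] [Module.FaithfullyFlat R S] :
    Function.Bijective
      (fun f : SpfSet I R =>
        (⟨SpfSet.map I (algebraMap R S) f, by
            apply Subtype.ext
            apply RingHom.ext
            intro a
            show (algebraMap R S) (f.1 a) ⊗ₜ[R] (1 : S) = (1 : S) ⊗ₜ[R] (algebraMap R S) (f.1 a)
            rw [Algebra.algebraMap_eq_smul_one, TensorProduct.smul_tmul]⟩ :
          {h : SpfSet I S //
            SpfSet.map I (Algebra.TensorProduct.includeLeftRingHom : S →+* S ⊗[R] S) h =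
              SpfSet.map I ((Algebra.TensorProduct.includeRight :
                S →ₐ[R] S ⊗[R] S) : S →+* S ⊗[R] S) h})) := by
  have hinj : Function.Injective (algebraMap R S) := FaithfulSMul.algebraMap_injective R S
  constructor
  · intro f g hfg
    have h1 := congrArg (fun x => x.1.1) hfg
    apply Subtype.ext
    apply RingHom.ext
    intro a
    exact hinj (RingHom.congr_fun h1 a)
  · rintro ⟨⟨f, n, hn1, hn⟩, hf⟩
    have hf' := congrArg (fun x => x.1) hf
    have hmem : ∀ a, ∃ r : R, algebraMap R S r = f a := by
      intro a
      have h2 : f a ∈ (Algebra.TensorProduct.includeLeftRingHom : S →+* S ⊗[R] S).eqLocus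
          Algebra.TensorProduct.includeRight.toRingHom := RingHom.congr_fun hf' a
      rw [← SetLike.mem_coe, Algebra.IsEffective.eqLocus_includeLeft_includeRight
        (Algebra.IsEffective.of_faithfullyFlat R S)] at h2
      exact h2
    choose g hg using hmem
    refine ⟨⟨{ toFun := g, map_one' := ?_, map_mul' := ?_, map_zero' := ?_, map_add' := ?_ },
      n, hn1, ?_⟩, ?_⟩
    · apply hinj; simp [hg]
    · intro a b; apply hinj; simp [hg]
    · apply hinj; simp [hg]
    · intro a b; apply hinj; simp [hg]
    · intro a ha
      apply hinj
      simp [hg, hn a ha]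
    · apply Subtype.ext
      apply Subtype.ext
      apply RingHom.ext
      exact hg
end

section
/- Let A → B be a homomorphism of commutative rings and let x ∈ A be an element that is a nonzerodivisor on A and whose image in B is a nonzerodivisor on B. If B/xB is faithfully flat over A/xA, then B/x^nB is faithfully flat over A/x^nA for every n ≥ 1. -/
/-!
If `B/xB` is faithfully flat over `A/xA` (with `x` a nonzerodivisor on both sides),
then `B/x^nB` is faithfully flat over `A/x^nA` for all `n ≥ 1`.
-/

/-- A ring homomorphism `φ : C →+* D` is faithfully flat if `D` is faithfully flat as a
`C`-module via `φ`. -/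
def IsFaithfullyFlatRingHom {C D : Type*} [CommRing C] [CommRing D] (φ : C →+* D) : Prop :=
  letI : Algebra C D := φ.toAlgebra
  Module.FaithfullyFlat C D

/-- The `n`-th power of the ideal `(x)` is contained in the preimage of the `n`-th power of
the ideal `(g x)`. -/
theorem span_pow_le_comap {A B : Type*} [CommRing A] [CommRing B] (g : A →+* B) (x : A)
    (n : ℕ) : Ideal.span {x} ^ n ≤ (Ideal.span {g x} ^ n).comap g := by
  rw [← Ideal.map_le_iff_le_comap, Ideal.map_pow, Ideal.map_span, Set.image_singleton]

/-- Relations modulo `x ^ n` are trivial modulo `x ^ n`. -/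
def TrivRelMod {A B : Type*} [CommRing A] [CommRing B] (g : A →+* B) (x : A) (n : ℕ) : Prop :=
  ∀ (ι : Type) [Fintype ι] (f : ι → A) (b : ι → B) (r : B),
    ∑ i, g (f i) * b i = (g x) ^ n * r →
    ∃ (κ : Type) (_ : Fintype κ) (a : ι → κ → A) (y : κ → B) (c : ι → B) (d : κ → A),
      (∀ i, b i = ∑ j, g (a i j) * y j + (g x) ^ n * c i) ∧
      ∀ j, ∑ i, f i * a i j = x ^ n * d j

theorem TrivRelMod.succ {A B : Type*} [CommRing A] [CommRing B] {g : A →+* B} {x : A} {n : ℕ}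
    (hxB : g x ∈ nonZeroDivisors B) (h1 : TrivRelMod g x 1) (hn : TrivRelMod g x n) :
    TrivRelMod g x (n + 1) := by
  intro ι _ f b r hr
  obtain ⟨κ, _, a, y, c, d, hb, ha⟩ := hn ι f b (g x * r) (by rw [hr]; ring)
  have ha' : ∀ j, ∑ i, g (f i) * g (a i j) = (g x) ^ n * g (d j) := by
    intro j
    have := congrArg g (ha j)
    simpa using this
  have key : ∑ s : κ ⊕ ι, g (Sum.elim d f s) * Sum.elim y c s = (g x) ^ 1 * r := by
    have hreg : (g x) ^ n ∈ nonZeroDivisors B := pow_mem hxB n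
    apply (mul_cancel_left_mem_nonZeroDivisors hreg).1
    rw [pow_one, ← mul_assoc, ← pow_succ, ← hr]
    simp only [Fintype.sum_sum_type, Sum.elim_inl, Sum.elim_inr]
    calc (g x) ^ n * (∑ j, g (d j) * y j + ∑ i, g (f i) * c i)
        = ∑ j, ((g x) ^ n * g (d j)) * y j + ∑ i, g (f i) * ((g x) ^ n * c i) := by
          rw [mul_add, Finset.mul_sum, Finset.mul_sum]
          congr 1 <;> exact Finset.sum_congr rfl fun _ _ => by ring
      _ = ∑ i, g (f i) * ∑ j, g (a i j) * y j + ∑ i, g (f i) * ((g x) ^ n * c i) := by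
          congr 1
          simp only [← ha', Finset.sum_mul, Finset.mul_sum]
          rw [Finset.sum_comm]
          exact Finset.sum_congr rfl fun _ _ => Finset.sum_congr rfl fun _ _ => by ring
      _ = ∑ i, g (f i) * b i := by
          rw [← Finset.sum_add_distrib]
          exact Finset.sum_congr rfl fun i _ => by rw [hb i]; ring
  obtain ⟨μ, _, p, z, e, w, hp, hw⟩ := h1 _ _ _ _ key
  simp only [Fintype.sum_sum_type, Sum.elim_inl, Sum.elim_inr, pow_one] at hw
  have hy : ∀ j, y j = ∑ k, g (p (Sum.inl j) k) * z k + g x * e (Sum.inl j) := fun j => by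
    simpa using hp (Sum.inl j)
  have hc : ∀ i, c i = ∑ k, g (p (Sum.inr i) k) * z k + g x * e (Sum.inr i) := fun i => by
    simpa using hp (Sum.inr i)
  refine ⟨μ ⊕ κ, inferInstance,
    fun i => Sum.elim (fun k => ∑ j, a i j * p (Sum.inl j) k + x ^ n * p (Sum.inr i) k)
      (fun j => x * a i j),
    Sum.elim z (fun j => e (Sum.inl j)), fun i => e (Sum.inr i), Sum.elim w d, ?_, ?_⟩
  · intro i
    simp only [Fintype.sum_sum_type, Sum.elim_inl, Sum.elim_inr]
    rw [hb i, hc i]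
    have e1 : ∑ j, g (a i j) * y j = ∑ k, (∑ j, g (a i j) * g (p (Sum.inl j) k)) * z k +
        ∑ j, g (x * a i j) * e (Sum.inl j) := by
      simp only [hy, mul_add, Finset.sum_add_distrib, Finset.mul_sum, Finset.sum_mul]
      congr 1
      · rw [Finset.sum_comm]
        exact Finset.sum_congr rfl fun _ _ => Finset.sum_congr rfl fun _ _ => by ring
      · exact Finset.sum_congr rfl fun _ _ => by rw [map_mul]; ring
    have e2 : ∑ k, g (∑ j, a i j * p (Sum.inl j) k + x ^ n * p (Sum.inr i) k) * z k =
        ∑ k, (∑ j, g (a i j) * g (p (Sum.inl j) k)) * z k +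
        (g x) ^ n * ∑ k, g (p (Sum.inr i) k) * z k := by
      rw [Finset.mul_sum, ← Finset.sum_add_distrib]
      refine Finset.sum_congr rfl fun k _ => ?_
      simp only [map_add, map_sum, map_mul, map_pow]
      ring
    rw [e1, e2]
    ring
  · rintro (k | j)
    · simp only [Sum.elim_inl]
      calc ∑ i, f i * (∑ j, a i j * p (Sum.inl j) k + x ^ n * p (Sum.inr i) k)
          = ∑ j, (∑ i, f i * a i j) * p (Sum.inl j) k + x ^ n * ∑ i, f i * p (Sum.inr i) k := by
            simp only [mul_add, Finset.sum_add_distrib, Finset.mul_sum, Finset.sum_mul]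
            congr 1
            · rw [Finset.sum_comm]
              exact Finset.sum_congr rfl fun _ _ => Finset.sum_congr rfl fun _ _ => by ring
            · exact Finset.sum_congr rfl fun _ _ => by ring
        _ = x ^ n * (∑ j, d j * p (Sum.inl j) k + ∑ i, f i * p (Sum.inr i) k) := by
            simp only [ha]
            rw [mul_add]
            congr 1
            rw [Finset.mul_sum]
            exact Finset.sum_congr rfl fun _ _ => by ring
        _ = x ^ (n + 1) * w k := by rw [hw k]; ring
    · simp only [Sum.elim_inr]
      rw [pow_succ, mul_comm (x ^ n) x, mul_assoc, ← ha j, Finset.mul_sum]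
      exact Finset.sum_congr rfl fun _ _ => by ring

theorem mk_span_pow_eq_iff {R : Type*} [CommRing R] (t : R) (n : ℕ) (u v : R) :
    Ideal.Quotient.mk (Ideal.span {t} ^ n) u = Ideal.Quotient.mk (Ideal.span {t} ^ n) v ↔
      ∃ c, u = v + t ^ n * c := by
  rw [Ideal.Quotient.eq, Ideal.span_singleton_pow, Ideal.mem_span_singleton]
  constructor
  · rintro ⟨c, hc⟩
    exact ⟨c, by rw [← hc]; ring⟩
  · rintro ⟨c, rfl⟩
    exact ⟨c, by ring⟩

/-- Lifting trivial relations along surjections of rings. -/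
theorem exists_lift_trivial {A B C D : Type*} [CommRing A] [CommRing B] [CommRing C] [CommRing D]
    [Algebra C D] [Module.Flat C D] (g : A →+* B) (π : A →+* C) (ρ : B →+* D)
    (hπ : Function.Surjective π) (hρ : Function.Surjective ρ)
    (hc : ∀ a, algebraMap C D (π a) = ρ (g a)) {ι : Type} [Fintype ι] (f : ι → A) (b : ι → B)
    (h : ρ (∑ i, g (f i) * b i) = 0) :
    ∃ (k : ℕ) (a : ι → Fin k → A) (y : Fin k → B),
      (∀ i, ρ (b i) = ρ (∑ j, g (a i j) * y j)) ∧ ∀ j, π (∑ i, f i * a i j) = 0 := by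
  have h0 : ∑ i, π (f i) • ρ (b i) = 0 := by
    rw [← h, map_sum]
    exact Finset.sum_congr rfl fun i _ => by rw [Algebra.smul_def, hc, map_mul]
  obtain ⟨k, a, y, hb, ha⟩ := Module.Flat.isTrivialRelation_of_sum_smul_eq_zero
    (R := C) (M := D) (f := fun i => π (f i)) (x := fun i => ρ (b i)) h0
  choose a' ha' using fun i j => hπ (a i j)
  choose y' hy' using fun j => hρ (y j)
  refine ⟨k, a', y', fun i => ?_, fun j => ?_⟩
  · refine (hb i).trans ?_
    rw [map_sum]
    exact Finset.sum_congr rfl fun j _ => by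
      rw [Algebra.smul_def, ← ha', hc, map_mul, hy']
  · rw [← ha j, map_sum]
    exact Finset.sum_congr rfl fun i _ => by rw [map_mul, ha']

theorem trivRelMod_of_flat {A B : Type*} [CommRing A] [CommRing B] (g : A →+* B) (x : A) (n : ℕ)
    (h : (Ideal.quotientMap (Ideal.span {g x} ^ n) g (span_pow_le_comap g x n)).Flat) :
    TrivRelMod g x n := by
  intro ι _ f b r hr
  let φ := Ideal.quotientMap (Ideal.span {g x} ^ n) g (span_pow_le_comap g x n)
  let _ : Algebra (A ⧸ Ideal.span {x} ^ n) (B ⧸ Ideal.span {g x} ^ n) := φ.toAlgebra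
  have : Module.Flat (A ⧸ Ideal.span {x} ^ n) (B ⧸ Ideal.span {g x} ^ n) := h
  obtain ⟨k, a, y, hb, ha⟩ := exists_lift_trivial g (Ideal.Quotient.mk (Ideal.span {x} ^ n))
    (Ideal.Quotient.mk (Ideal.span {g x} ^ n)) Ideal.Quotient.mk_surjective
    Ideal.Quotient.mk_surjective (fun _ => rfl) f b (by
      rw [← map_zero (Ideal.Quotient.mk (Ideal.span {g x} ^ n)), mk_span_pow_eq_iff]
      exact ⟨r, by rw [hr, zero_add]⟩)
  choose c hc using fun i => (mk_span_pow_eq_iff _ _ _ _).1 (hb i)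
  choose d hd using fun j => (mk_span_pow_eq_iff _ _ _ _).1 ((ha j).trans (map_zero _).symm)
  exact ⟨Fin k, inferInstance, a, y, c, d, hc, fun j => by rw [hd j, zero_add]⟩

theorem flat_of_trivRelMod {A B : Type*} [CommRing A] [CommRing B] (g : A →+* B) (x : A) (n : ℕ)
    (h : TrivRelMod g x n) :
    (Ideal.quotientMap (Ideal.span {g x} ^ n) g (span_pow_le_comap g x n)).Flat := by
  let φ := Ideal.quotientMap (Ideal.span {g x} ^ n) g (span_pow_le_comap g x n)
  let _ : Algebra (A ⧸ Ideal.span {x} ^ n) (B ⧸ Ideal.span {g x} ^ n) := φ.toAlgebra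
  change Module.Flat (A ⧸ Ideal.span {x} ^ n) (B ⧸ Ideal.span {g x} ^ n)
  have hsm : ∀ (s : A) (t : B ⧸ Ideal.span {g x} ^ n),
      (Ideal.Quotient.mk (Ideal.span {x} ^ n) s) • t =
        Ideal.Quotient.mk (Ideal.span {g x} ^ n) (g s) * t := fun s t => rfl
  refine Module.Flat.of_forall_isTrivialRelation ?_
  intro l f b h0
  choose f' hf' using fun j => Ideal.Quotient.mk_surjective (f j)
  choose b' hb' using fun j => Ideal.Quotient.mk_surjective (b j)
  have h0' : ∃ r, ∑ i, g (f' i) * b' i = 0 + (g x) ^ n * r := by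
    rw [← mk_span_pow_eq_iff, map_zero, ← h0]
    simp only [← hf', ← hb', hsm, map_sum, map_mul]
  obtain ⟨r, hr⟩ := h0'
  obtain ⟨κ, _, a, y, c, d, hb, ha⟩ := h (Fin l) f' b' r (by rw [hr, zero_add])
  rw [Module.isTrivialRelation_iff_vanishesTrivially]
  refine TensorProduct.VanishesTrivially.of_fintype
    (fun i j => Ideal.Quotient.mk _ (a i j)) (fun j => Ideal.Quotient.mk _ (y j)) ?_ ?_
  · intro i
    simp only [hsm, ← hb', ← map_mul, ← map_sum]
    rw [mk_span_pow_eq_iff]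
    exact ⟨c i, hb i⟩
  · intro j
    simp only [← hf', smul_eq_mul, ← map_mul, ← map_sum]
    rw [← map_zero (Ideal.Quotient.mk (Ideal.span {x} ^ n)), mk_span_pow_eq_iff]
    exact ⟨d j, by rw [zero_add, ← ha j]; exact Finset.sum_congr rfl fun _ _ => by ring⟩

theorem isFaithfullyFlatRingHom_iff {C D : Type*} [CommRing C] [CommRing D] (φ : C →+* D) :
    IsFaithfullyFlatRingHom φ ↔ φ.Flat ∧ ∀ m : Ideal C, m.IsMaximal → m.map φ ≠ ⊤ := by
  let _ : Algebra C D := φ.toAlgebra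
  change Module.FaithfullyFlat C D ↔ Module.Flat C D ∧ _
  rw [Module.faithfullyFlat_iff]
  refine and_congr_right fun _ => forall_congr' fun m => forall_congr' fun _ => ?_
  rw [Ideal.smul_top_eq_map, ne_eq, Submodule.restrictScalars_eq_top_iff]
  rfl

/-- Let `A → B` be a homomorphism of commutative rings and `x ∈ A` a nonzerodivisor on `A`
whose image is a nonzerodivisor on `B`.  If `B/xB` is faithfully flat over `A/xA`, then
`B/x^nB` is faithfully flat over `A/x^nA` for every `n ≥ 1`. -/
theorem faithfullyFlat_quotient_pow {A B : Type*} [CommRing A] [CommRing B]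
    (g : A →+* B) (x : A) (hxA : x ∈ nonZeroDivisors A) (hxB : g x ∈ nonZeroDivisors B)
    (h1 : IsFaithfullyFlatRingHom
      (Ideal.quotientMap (Ideal.span {g x} ^ 1) g (span_pow_le_comap g x 1)))
    (n : ℕ) (hn : 1 ≤ n) :
    IsFaithfullyFlatRingHom
      (Ideal.quotientMap (Ideal.span {g x} ^ n) g (span_pow_le_comap g x n)) := by
  rw [isFaithfullyFlatRingHom_iff]
  rw [isFaithfullyFlatRingHom_iff] at h1
  obtain ⟨hfl, hmax⟩ := h1
  have t1 := trivRelMod_of_flat g x 1 hfl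
  refine ⟨flat_of_trivRelMod g x n ?_, ?_⟩
  · induction n, hn using Nat.le_induction with
    | base => exact t1
    | succ k _ ih => exact t1.succ hxB ih
  · intro m hm htop
    let α : (A ⧸ Ideal.span {x} ^ n) →+* (A ⧸ Ideal.span {x} ^ 1) :=
      Ideal.Quotient.factor (Ideal.pow_le_pow_right hn)
    let β : (B ⧸ Ideal.span {g x} ^ n) →+* (B ⧸ Ideal.span {g x} ^ 1) :=
      Ideal.Quotient.factor (Ideal.pow_le_pow_right hn)
    have hα : Function.Surjective α := Ideal.Quotient.factor_surjective _
    have hcomm : β.comp (Ideal.quotientMap (Ideal.span {g x} ^ n) g (span_pow_le_comap g x n)) =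
        (Ideal.quotientMap (Ideal.span {g x} ^ 1) g (span_pow_le_comap g x 1)).comp α := by
      apply Ideal.Quotient.ringHom_ext
      ext a
      rfl
    have hker : RingHom.ker α ≤ m := by
      intro u hu
      obtain ⟨a, rfl⟩ := Ideal.Quotient.mk_surjective u
      have ha : a ∈ Ideal.span {x} := by
        rw [← pow_one (Ideal.span {x})]
        exact Ideal.Quotient.eq_zero_iff_mem.1 hu
      apply hm.isPrime.mem_of_pow_mem n
      rw [← map_pow, Ideal.Quotient.eq_zero_iff_mem.2 (Ideal.pow_mem_pow ha n)]
      exact m.zero_mem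
    have h2 : (m.map α).map
        (Ideal.quotientMap (Ideal.span {g x} ^ 1) g (span_pow_le_comap g x 1)) = ⊤ := by
      rw [Ideal.map_map, ← hcomm, ← Ideal.map_map, htop, Ideal.map_top]
    rcases Ideal.map_eq_top_or_isMaximal_of_surjective α hα hm with h3 | h3
    · apply hm.ne_top
      have := Ideal.comap_map_of_surjective' α hα m
      rw [h3, Ideal.comap_top, sup_eq_left.2 hker] at this
      exact this.symm
    · exact hmax _ h3 h2
end
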